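/- Let N ≥ 1 be an integer and let f : ℝ^N → ℝ be measurable with 0 ≤ f(z) ≤ M₁ for almost every z and ∫_{ℝ^N} f(z)|z|² dz ≤ M₂, where M₁ > 0 and M₂ ≥ 0. Then ∫_{ℝ^N} f(z) dz ≤ (M₁|B₁|)^{2/(N+2)} (M₂ (N+2)/N)^{N/(N+2)}, where |B₁| is the volume of the unit ball of ℝ^N. -/

import Mathlib

open MeasureTheory

noncomputable section

/-- Volume of the unit ball in ℝ^N. -/
def unitBallVol (N : ℕ) : ℝ := (volume (Metric.ball (0 : EuclideanSpace ℝ (Fin N)) 1)).toReal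

lemma unitBallVol_pos (N : ℕ) : 0 < unitBallVol N :=
  ENNReal.toReal_pos (Metric.measure_ball_pos volume _ one_pos).ne' measure_ball_lt_top.ne

lemma integrable_sq_sub_norm_sq_posPart (N : ℕ) (r : ℝ) :
    Integrable (fun z : EuclideanSpace ℝ (Fin N) => max (r ^ 2 - ‖z‖ ^ 2) 0) := by
  apply Continuous.integrable_of_hasCompactSupport (by fun_prop)
  apply HasCompactSupport.intro (isCompact_closedBall (0 : EuclideanSpace ℝ (Fin N)) |r|)
  intro z hz
  rw [mem_closedBall_zero_iff, not_le] at hz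
  have : r ^ 2 ≤ ‖z‖ ^ 2 := sq_le_sq.mpr (by rw [abs_norm]; exact hz.le)
  exact max_eq_right (by linarith)

lemma setIntegral_Ioi_pow_mul_sq_sub_sq_posPart (n : ℕ) {r : ℝ} (hr : 0 < r) :
    ∫ y in Set.Ioi (0 : ℝ), y ^ n * max (r ^ 2 - y ^ 2) 0 =
      2 * r ^ (n + 3) / (((n : ℝ) + 1) * ((n : ℝ) + 3)) := by
  have hcut : ∫ y in Set.Ioi (0 : ℝ), y ^ n * max (r ^ 2 - y ^ 2) 0 =
      ∫ y in Set.Ioc (0 : ℝ) r, y ^ n * max (r ^ 2 - y ^ 2) 0 := by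
    refine setIntegral_eq_of_subset_of_forall_sdiff_eq_zero measurableSet_Ioi
      Set.Ioc_subset_Ioi_self ?_
    rintro y ⟨hy0, hy⟩
    have hy0' : 0 < y := hy0
    have hry : r < y := by
      by_contra h
      exact hy ⟨hy0, not_lt.mp h⟩
    rw [max_eq_right (by nlinarith), mul_zero]
  have hpoly : ∫ y in Set.Ioc (0 : ℝ) r, y ^ n * max (r ^ 2 - y ^ 2) 0 =
      ∫ y in Set.Ioc (0 : ℝ) r, (r ^ 2 * y ^ n - y ^ (n + 2)) := by
    refine setIntegral_congr_fun measurableSet_Ioc fun y hy => ?_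
    obtain ⟨hy0, hyr⟩ := hy
    rw [max_eq_left (by nlinarith)]
    ring
  rw [hcut, hpoly, ← intervalIntegral.integral_of_le hr.le,
    intervalIntegral.integral_sub (Continuous.intervalIntegrable (by fun_prop) _ _)
      (Continuous.intervalIntegrable (by fun_prop) _ _),
    intervalIntegral.integral_const_mul, integral_pow, integral_pow]
  push_cast
  simp only [ne_eq, Nat.add_eq_zero_iff, one_ne_zero, and_false, not_false_eq_true, zero_pow,
    OfNat.ofNat_ne_zero, sub_zero]
  have h1 : (n : ℝ) + 1 ≠ 0 := by positivity
  have h3 : (n : ℝ) + 3 ≠ 0 := by positivity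
  have h3' : (n : ℝ) + 2 + 1 ≠ 0 := by positivity
  field_simp
  ring

lemma integral_sq_sub_norm_sq_posPart {N : ℕ} (hN : 1 ≤ N) {r : ℝ} (hr : 0 < r) :
    ∫ z : EuclideanSpace ℝ (Fin N), max (r ^ 2 - ‖z‖ ^ 2) 0 =
      2 * unitBallVol N * r ^ (N + 2) / ((N : ℝ) + 2) := by
  obtain ⟨n, rfl⟩ := Nat.exists_eq_add_of_le' hN
  rw [integral_fun_norm_addHaar volume (fun y : ℝ => max (r ^ 2 - y ^ 2) 0)]
  simp only [finrank_euclideanSpace, Fintype.card_fin, Nat.add_sub_cancel, smul_eq_mul,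
    nsmul_eq_mul, setIntegral_Ioi_pow_mul_sq_sub_sq_posPart n hr]
  change ((n + 1 : ℕ) : ℝ) * (unitBallVol (n + 1) * _) = _
  push_cast
  have h1 : (n : ℝ) + 1 ≠ 0 := by positivity
  have h3 : (n : ℝ) + 3 ≠ 0 := by positivity
  have h3' : (n : ℝ) + 1 + 2 ≠ 0 := by positivity
  field_simp
  ring

/-- The bound obtained by comparing `f` with the bathtub profile `M₁ 1_{|z| ≤ r}`. -/
lemma lintegral_le_of_radius {N : ℕ} (hN : 1 ≤ N) {f : EuclideanSpace ℝ (Fin N) → ℝ}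
    (hf : Measurable f) {M₁ M₂ : ℝ} (hM₁ : 0 < M₁) (hM₂ : 0 ≤ M₂)
    (hbd : ∀ᵐ z, 0 ≤ f z ∧ f z ≤ M₁)
    (hmom : ∫⁻ z, ENNReal.ofReal (f z * ‖z‖ ^ 2) ≤ ENNReal.ofReal M₂) {r : ℝ} (hr : 0 < r) :
    ∫⁻ z, ENNReal.ofReal (f z) ≤
      ENNReal.ofReal
        ((M₂ + M₁ * (2 * unitBallVol N * r ^ (N + 2) / ((N : ℝ) + 2))) / r ^ 2) := by
  have hr2 : 0 < r ^ 2 := by positivity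
  have hV := unitBallVol_pos N
  rw [ENNReal.ofReal_div_of_pos hr2,
    ENNReal.le_div_iff_mul_le (Or.inl (by simpa using hr.ne')) (Or.inl ENNReal.ofReal_ne_top),
    ← lintegral_mul_const _ hf.ennreal_ofReal]
  calc ∫⁻ z, ENNReal.ofReal (f z) * ENNReal.ofReal (r ^ 2)
      ≤ ∫⁻ z, (ENNReal.ofReal (f z * ‖z‖ ^ 2) +
          ENNReal.ofReal (M₁ * max (r ^ 2 - ‖z‖ ^ 2) 0)) := by
        refine lintegral_mono_ae ?_
        filter_upwards [hbd] with z ⟨h0, h1⟩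
        rw [← ENNReal.ofReal_mul h0, ← ENNReal.ofReal_add (by positivity) (by positivity)]
        apply ENNReal.ofReal_le_ofReal
        have ha := le_max_left (r ^ 2 - ‖z‖ ^ 2) 0
        have hb := le_max_right (r ^ 2 - ‖z‖ ^ 2) 0
        nlinarith [mul_le_mul_of_nonneg_left ha h0, mul_le_mul_of_nonneg_right h1 hb]
    _ = (∫⁻ z, ENNReal.ofReal (f z * ‖z‖ ^ 2)) +
          ∫⁻ z : EuclideanSpace ℝ (Fin N), ENNReal.ofReal (M₁ * max (r ^ 2 - ‖z‖ ^ 2) 0) :=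
        lintegral_add_left (by fun_prop) _
    _ ≤ ENNReal.ofReal (M₂ + M₁ * (2 * unitBallVol N * r ^ (N + 2) / ((N : ℝ) + 2))) := by
        rw [ENNReal.ofReal_add hM₂ (by positivity),
          ← ofReal_integral_eq_lintegral_ofReal
            ((integrable_sq_sub_norm_sq_posPart N r).const_mul M₁)
            (Filter.Eventually.of_forall fun z => by positivity),
          integral_const_mul, integral_sq_sub_norm_sq_posPart hN hr]
        exact add_le_add hmom le_rfl

/-- Li–Yau's lemma: if `0 ≤ f ≤ M₁` a.e. and `∫ f(z)|z|² dz ≤ M₂`, then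
`∫ f ≤ (M₁|B₁|)^{2/(N+2)} (M₂(N+2)/N)^{N/(N+2)}`. -/
theorem li_yau_lemma
    (N : ℕ) (hN : 1 ≤ N) (f : EuclideanSpace ℝ (Fin N) → ℝ) (hf : Measurable f)
    (M₁ M₂ : ℝ) (hM₁ : 0 < M₁) (hM₂ : 0 ≤ M₂)
    (hbd : ∀ᵐ z, 0 ≤ f z ∧ f z ≤ M₁)
    (hmom : ∫⁻ z, ENNReal.ofReal (f z * ‖z‖ ^ 2) ≤ ENNReal.ofReal M₂) :
    ∫⁻ z, ENNReal.ofReal (f z) ≤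
      ENNReal.ofReal
        ((M₁ * unitBallVol N) ^ ((2 : ℝ) / ((N : ℝ) + 2)) *
          (M₂ * ((N : ℝ) + 2) / N) ^ ((N : ℝ) / ((N : ℝ) + 2))) := by
  have hV := unitBallVol_pos N
  have hNpos : (0 : ℝ) < N := by exact_mod_cast hN
  have hN2 : (N : ℝ) + 2 ≠ 0 := by positivity
  have key := fun r hr => lintegral_le_of_radius hN hf hM₁ hM₂ hbd hmom (r := r) hr
  rcases hM₂.eq_or_lt with rfl | hM₂pos
  · refine le_trans ?_ zero_le
    have hlim : Filter.Tendsto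
        (fun r : ℝ => ENNReal.ofReal (M₁ * (2 * unitBallVol N * r ^ N / ((N : ℝ) + 2))))
        (nhdsWithin 0 (Set.Ioi 0)) (nhds 0) := by
      have hc : Continuous
          (fun r : ℝ => ENNReal.ofReal (M₁ * (2 * unitBallVol N * r ^ N / ((N : ℝ) + 2)))) :=
        ENNReal.continuous_ofReal.comp (by fun_prop)
      have h := hc.tendsto 0
      simp only [zero_pow (Nat.one_le_iff_ne_zero.mp hN), mul_zero, zero_div,
        ENNReal.ofReal_zero] at h
      exact h.mono_left nhdsWithin_le_nhds
    refine ge_of_tendsto hlim ?_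
    filter_upwards [self_mem_nhdsWithin] with r hr
    have hr0 : (0 : ℝ) < r := hr
    refine (key r hr0).trans_eq (congrArg _ ?_)
    field_simp
    ring
  · have hA : 0 < M₁ * unitBallVol N := mul_pos hM₁ hV
    set B := M₂ * ((N : ℝ) + 2) / N with hB
    have hBpos : 0 < B := by positivity
    set r := (B / (M₁ * unitBallVol N)) ^ (((N : ℝ) + 2)⁻¹) with hr
    have hr0 : 0 < r := by positivity
    have hrpow : r ^ (N + 2) = B / (M₁ * unitBallVol N) := by
      rw [hr, ← Real.rpow_natCast, ← Real.rpow_mul (by positivity)]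
      push_cast
      rw [inv_mul_cancel₀ hN2, Real.rpow_one]
    have hr2 : r ^ 2 = (B / (M₁ * unitBallVol N)) ^ (2 / ((N : ℝ) + 2)) := by
      rw [hr, ← Real.rpow_natCast, ← Real.rpow_mul (by positivity)]
      congr 1
      push_cast
      ring
    refine (key r hr0).trans_eq (congrArg _ ?_)
    have hnum : M₂ + M₁ * (2 * unitBallVol N * r ^ (N + 2) / ((N : ℝ) + 2)) = B := by
      rw [hrpow, hB]
      field_simp
    have hexp : (N : ℝ) / ((N : ℝ) + 2) = 1 - 2 / ((N : ℝ) + 2) := by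
      field_simp
      ring
    rw [hnum, hr2, Real.div_rpow hBpos.le hA.le, hexp, Real.rpow_sub hBpos, Real.rpow_one]
    field_simp

end
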